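/- Let γ ∈ ℝ with γ ≠ 0 and |γ| ≠ 1, and let b, b₁, c₁ ∈ (1/4, 1/2) satisfy b + b₁ + c₁ ≥ 1. Then there exists a constant C > 0 (depending on γ, b, b₁, c₁) such that for all nonnegative measurable functions f, g, h : ℝ² → [0,∞): ∫_{ℝ⁴} [ h(τ,ξ) · ⟨ξ₁⟩^{1/2} · f(τ₁,ξ₁) · g(τ−τ₁, ξ−ξ₁) ] / [ ⟨τ+ξ²⟩^{c₁} · ⟨τ₁+γ|ξ₁|ξ₁⟩^{b} · ⟨τ−τ₁+(ξ−ξ₁)²⟩^{b₁} ] dξ dξ₁ dτ dτ₁ ≤ C · ‖f‖_{L²(ℝ²)} · ‖g‖_{L²(ℝ²)} · ‖h‖_{L²(ℝ²)}. (This is the dual formulation of the bilinear estimate ‖uv‖_{X^{0,−c₁}} ≲ ‖u‖_{Y_γ^{−1/2,b}} ‖v‖_{X^{0,b₁}}.) -/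

import Mathlib

open MeasureTheory ENNReal

/-- Japanese bracket `⟨x⟩ = 1 + |x|`. -/
noncomputable def jb (x : ℝ) : ℝ := 1 + |x|

/-- The `L²` norm (valued in `ℝ≥0∞`) of a nonnegative function on `ℝ²`. -/
noncomputable def l2R2 (f : ℝ × ℝ → ℝ) : ℝ≥0∞ :=
  (∫⁻ p : ℝ × ℝ, ENNReal.ofReal (f p) ^ 2) ^ (1/2 : ℝ)

/-- Japanese bracket as an extended nonnegative real. -/
noncomputable def eJ (x : ℝ) : ℝ≥0∞ := ENNReal.ofReal (jb x)

/-- Absolute value as an extended nonnegative real. -/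
noncomputable def eA (x : ℝ) : ℝ≥0∞ := ENNReal.ofReal |x|

lemma one_le_jb (x : ℝ) : 1 ≤ jb x := by unfold jb; linarith [abs_nonneg x]
lemma jb_pos (x : ℝ) : 0 < jb x := lt_of_lt_of_le one_pos (one_le_jb x)
lemma one_le_eJ (x : ℝ) : 1 ≤ eJ x := by
  unfold eJ; rw [← ENNReal.ofReal_one]; exact ENNReal.ofReal_le_ofReal (one_le_jb x)
lemma eJ_ne_top (x : ℝ) : eJ x ≠ ⊤ := ENNReal.ofReal_ne_top
lemma eJ_ne_zero (x : ℝ) : eJ x ≠ 0 := (lt_of_lt_of_le one_pos (one_le_eJ x)).ne'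
lemma eA_ne_top (x : ℝ) : eA x ≠ ⊤ := ENNReal.ofReal_ne_top
lemma eA_le_eJ (x : ℝ) : eA x ≤ eJ x := by
  unfold eA eJ jb; exact ENNReal.ofReal_le_ofReal (by linarith)
lemma measurable_jb : Measurable jb := by unfold jb; fun_prop
@[fun_prop] lemma measurable_eJ : Measurable eJ := by
  unfold eJ; exact ENNReal.measurable_ofReal.comp measurable_jb
@[fun_prop] lemma measurable_eA : Measurable eA := by
  unfold eA; fun_prop

lemma e_anti {x y : ℝ≥0∞} {s : ℝ} (hs : 0 ≤ s) (h : x ≤ y) : y ^ (-s) ≤ x ^ (-s) := by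
  rw [ENNReal.rpow_neg, ENNReal.rpow_neg]
  exact ENNReal.inv_le_inv.2 (ENNReal.rpow_le_rpow h hs)

lemma lintegral_even_le (φ : ℝ → ℝ≥0∞) :
    ∫⁻ x, φ |x| ≤ 2 * ∫⁻ x in Set.Ioi (0:ℝ), φ x := by
  have h0 : ∫⁻ x, φ |x| = ∫⁻ x in ({0}ᶜ : Set ℝ), φ |x| := by
    rw [MeasureTheory.restrict_compl_singleton]
  have hU : ({0}ᶜ : Set ℝ) ⊆ Set.Ioi 0 ∪ Set.Iio 0 := by
    intro x hx
    rcases lt_or_gt_of_ne (show x ≠ 0 from hx) with h | h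
    · right; exact h
    · left; exact h
  have hneg : ∫⁻ x in Set.Iio (0:ℝ), φ |x| = ∫⁻ x in Set.Ioi (0:ℝ), φ x := by
    rw [← lintegral_indicator measurableSet_Iio, ← lintegral_indicator measurableSet_Ioi]
    rw [← lintegral_neg_eq_self]
    congr 1; ext x
    by_cases hx : 0 < x
    · simp [Set.indicator, hx, abs_of_pos hx]
    · simp [Set.indicator, hx]
  have hpos : ∫⁻ x in Set.Ioi (0:ℝ), φ |x| = ∫⁻ x in Set.Ioi (0:ℝ), φ x := by
    refine setLIntegral_congr_fun measurableSet_Ioi ?_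
    intro x hx
    simp only [abs_of_pos (show 0 < x from hx)]
  calc ∫⁻ x, φ |x| ≤ ∫⁻ x in (Set.Ioi 0 ∪ Set.Iio 0 : Set ℝ), φ |x| := by
        rw [h0]; exact lintegral_mono_set hU
    _ ≤ _ := lintegral_union_le _ _ _
    _ = _ := by rw [hneg, hpos, two_mul]

lemma int_near {s R : ℝ} (hs1 : s < 1) (hR : 0 < R) :
    ∫⁻ x in {x : ℝ | |x| ≤ R}, eA x ^ (-s) ≤ ENNReal.ofReal (2 / (1 - s) * R ^ (1 - s)) := by
  have hm : MeasurableSet {x : ℝ | |x| ≤ R} := measurableSet_le (by fun_prop) (by fun_prop)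
  rw [← lintegral_indicator hm]
  have := lintegral_even_le (fun y => (Set.Iic R).indicator (fun y => ENNReal.ofReal y ^ (-s)) y)
  calc _ = _ := ?_
    _ ≤ _ := this
    _ = _ := ?_
  · congr 1
  · rw [lintegral_indicator measurableSet_Iic, Measure.restrict_restrict measurableSet_Iic,
      Set.inter_comm, Set.Ioi_inter_Iic]
    have hint : IntegrableOn (fun x : ℝ => x ^ (-s)) (Set.Ioc 0 R) :=
      (intervalIntegrable_iff_integrableOn_Ioc_of_le hR.le).1
        (intervalIntegral.intervalIntegrable_rpow' (by linarith))
    have h1 : ∫⁻ x in Set.Ioc 0 R, ENNReal.ofReal x ^ (-s)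
        = ∫⁻ x in Set.Ioc 0 R, ENNReal.ofReal (x ^ (-s)) := by
      refine setLIntegral_congr_fun measurableSet_Ioc ?_
      intro x hx
      exact ENNReal.ofReal_rpow_of_pos hx.1
    rw [h1, ← ofReal_integral_eq_lintegral_ofReal hint, ← intervalIntegral.integral_of_le hR.le,
      integral_rpow (by left; linarith)]
    · rw [show (2:ℝ≥0∞) = ENNReal.ofReal 2 by simp, ← ENNReal.ofReal_mul (by norm_num)]
      congr 1
      rw [Real.zero_rpow (by linarith), show -s + 1 = 1 - s by ring]
      ring
    · filter_upwards [ae_restrict_mem measurableSet_Ioc] with x hx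
      exact Real.rpow_nonneg hx.1.le _

lemma int_far {s R : ℝ} (hs1 : 1 < s) (hR : 0 < R) :
    ∫⁻ x in {x : ℝ | R < |x|}, eA x ^ (-s) ≤ ENNReal.ofReal (2 / (s - 1) * R ^ (1 - s)) := by
  have hm : MeasurableSet {x : ℝ | R < |x|} := measurableSet_lt (by fun_prop) (by fun_prop)
  rw [← lintegral_indicator hm]
  have := lintegral_even_le (fun y => (Set.Ioi R).indicator (fun y => ENNReal.ofReal y ^ (-s)) y)
  calc _ = _ := ?_
    _ ≤ _ := this
    _ = _ := ?_
  · congr 1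
  · rw [lintegral_indicator measurableSet_Ioi, Measure.restrict_restrict measurableSet_Ioi,
      Set.Ioi_inter_Ioi, sup_of_le_left hR.le]
    have hint : IntegrableOn (fun x : ℝ => x ^ (-s)) (Set.Ioi R) :=
      integrableOn_Ioi_rpow_of_lt (by linarith) hR
    have h1 : ∫⁻ x in Set.Ioi R, ENNReal.ofReal x ^ (-s)
        = ∫⁻ x in Set.Ioi R, ENNReal.ofReal (x ^ (-s)) := by
      refine setLIntegral_congr_fun measurableSet_Ioi ?_
      intro x hx
      exact ENNReal.ofReal_rpow_of_pos (hR.trans hx)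
    rw [h1, ← ofReal_integral_eq_lintegral_ofReal hint,
      integral_Ioi_rpow_of_lt (by linarith) hR]
    · rw [show (2:ℝ≥0∞) = ENNReal.ofReal 2 by simp, ← ENNReal.ofReal_mul (by norm_num)]
      congr 1
      rw [show -s + 1 = 1 - s by ring]
      have : 1 - s ≠ 0 := by linarith
      have : s - 1 ≠ 0 := by linarith
      field_simp
      ring
    · filter_upwards [ae_restrict_mem measurableSet_Ioi] with x hx
      exact Real.rpow_nonneg (hR.trans hx).le _

/-- `∫_S |x-r|^{-s} ≤ C R^{1-s}` when `|S| ≤ 2R`. -/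
lemma int_set {s R : ℝ} (hs0 : 0 ≤ s) (hs1 : s < 1) (hR : 0 < R) (r : ℝ) (S : Set ℝ)
    (hS : volume S ≤ ENNReal.ofReal (2 * R)) :
    ∫⁻ x in S, eA (x - r) ^ (-s) ≤ ENNReal.ofReal ((2 / (1 - s) + 2) * R ^ (1 - s)) := by
  have hm : MeasurableSet {x : ℝ | |x| ≤ R} := measurableSet_le (by fun_prop) (by fun_prop)
  have hpt : ∀ x, eA (x - r) ^ (-s) ≤ ({x : ℝ | |x| ≤ R}.indicator (fun x => eA x ^ (-s)) (x - r))
      + ENNReal.ofReal (R ^ (-s)) := by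
    intro x
    by_cases hx : |x - r| ≤ R
    · simp [Set.indicator, hx]
    · simp only [Set.indicator, Set.mem_ofPred_eq, hx, if_false, zero_add]
      rw [← ENNReal.ofReal_rpow_of_pos hR]
      exact e_anti hs0 (ENNReal.ofReal_le_ofReal (not_le.1 hx).le)
  have hp : 0 ≤ 2 / (1 - s) := div_nonneg (by norm_num) (by linarith)
  have hRR : R ^ (-s) * (2 * R) = 2 * R ^ (1 - s) := by
    rw [show (1 - s) = -s + 1 by ring, Real.rpow_add hR, Real.rpow_one]; ring
  calc _ ≤ ∫⁻ x in S, (({x : ℝ | |x| ≤ R}.indicator (fun x => eA x ^ (-s)) (x - r))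
      + ENNReal.ofReal (R ^ (-s))) := lintegral_mono hpt
    _ = (∫⁻ x in S, ({x : ℝ | |x| ≤ R}.indicator (fun x => eA x ^ (-s)) (x - r)))
        + ENNReal.ofReal (R ^ (-s)) * volume S := by
      rw [lintegral_add_right _ measurable_const, setLIntegral_const]
    _ ≤ (∫⁻ x, ({x : ℝ | |x| ≤ R}.indicator (fun x => eA x ^ (-s)) (x - r)))
        + ENNReal.ofReal (R ^ (-s)) * ENNReal.ofReal (2 * R) := by
      gcongr
      exact Measure.restrict_le_self
    _ ≤ ENNReal.ofReal (2 / (1 - s) * R ^ (1 - s))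
        + ENNReal.ofReal (R ^ (-s)) * ENNReal.ofReal (2 * R) := by
      gcongr
      rw [lintegral_sub_right_eq_self, lintegral_indicator hm]
      exact int_near hs1 hR
    _ = _ := by
      rw [← ENNReal.ofReal_mul (by positivity), ← ENNReal.ofReal_add (by positivity)
        (by positivity), hRR]
      congr 1; ring

lemma tau_phi {p q M : ℝ} (hp1 : p < 1) (hpq : 1 < p + q) (hM : 0 < M) (A : ℝ) :
    ∫⁻ t, (ENNReal.ofReal ((M / 2) ^ (-q)) *
        ({x : ℝ | |x| ≤ M}.indicator (fun x => eA x ^ (-p)) (t + A))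
      + {x : ℝ | M < |x|}.indicator (fun x => eA x ^ (-(p + q))) (t + A))
    ≤ ENNReal.ofReal ((2 ^ q * (2 / (1 - p)) + 2 / (p + q - 1)) * M ^ (-(p + q - 1))) := by
  have hm : MeasurableSet {x : ℝ | |x| ≤ M} := measurableSet_le (by fun_prop) (by fun_prop)
  have hm2 : MeasurableSet {x : ℝ | M < |x|} := measurableSet_lt (by fun_prop) (by fun_prop)
  rw [lintegral_add_right_eq_self (μ := volume) (fun t => (ENNReal.ofReal ((M / 2) ^ (-q)) *
        ({x : ℝ | |x| ≤ M}.indicator (fun x => eA x ^ (-p)) t)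
      + {x : ℝ | M < |x|}.indicator (fun x => eA x ^ (-(p + q))) t)) A]
  have hmeas : ∀ s : ℝ, Measurable (fun x => eA x ^ s) := fun s => measurable_eA.pow_const s
  rw [lintegral_add_right _ ((hmeas _).indicator hm2),
    lintegral_const_mul _ ((hmeas _).indicator hm), lintegral_indicator hm, lintegral_indicator hm2]
  have h1 := int_near hp1 hM
  have h2 := int_far hpq hM
  have e1 : 0 ≤ 2 / (1 - p) := div_nonneg (by norm_num) (by linarith)
  have e2 : 0 ≤ 2 / (p + q - 1) := div_nonneg (by norm_num) (by linarith)
  calc _ ≤ ENNReal.ofReal ((M / 2) ^ (-q)) * ENNReal.ofReal (2 / (1 - p) * M ^ (1 - p))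
        + ENNReal.ofReal (2 / (p + q - 1) * M ^ (1 - (p + q))) := by gcongr
    _ = _ := by
      rw [← ENNReal.ofReal_mul (by positivity), ← ENNReal.ofReal_add (by positivity)
        (by positivity)]
      congr 1
      rw [Real.div_rpow hM.le (by norm_num), Real.rpow_neg (by norm_num : (0:ℝ) ≤ 2),
        show -(p + q - 1) = -q + (1 - p) by ring, show 1 - (p + q) = -q + (1 - p) by ring,
        Real.rpow_add hM]
      have : (2:ℝ) ^ q ≠ 0 := by positivity
      field_simp

lemma tau_pt {p q u v M : ℝ} (hp0 : 0 ≤ p) (hq0 : 0 ≤ q) (hM : M = jb (u - v))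
    (h : jb u ≤ jb v) :
    eJ u ^ (-p) * eJ v ^ (-q) ≤ (ENNReal.ofReal ((M / 2) ^ (-q)) *
        ({x : ℝ | |x| ≤ M}.indicator (fun x => eA x ^ (-p)) u)
      + {x : ℝ | M < |x|}.indicator (fun x => eA x ^ (-(p + q))) u) := by
  have hM0 : 0 < M := hM ▸ jb_pos _
  by_cases hu : |u| ≤ M
  · have hv : M / 2 ≤ jb v := by
      have := abs_sub u v
      unfold jb at *
      linarith [abs_nonneg u]
    simp only [Set.indicator, Set.mem_ofPred_eq, hu, if_true, not_lt.2 hu, if_false, add_zero]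
    rw [mul_comm, ← ENNReal.ofReal_rpow_of_pos (by positivity)]
    exact mul_le_mul' (e_anti hq0 (ENNReal.ofReal_le_ofReal hv)) (e_anti hp0 (eA_le_eJ u))
  · have hu' := not_le.1 hu
    simp only [Set.indicator, Set.mem_ofPred_eq, hu, if_true, hu', if_false, mul_zero, zero_add]
    have h0 : eA u ≠ 0 := by
      unfold eA
      rw [Ne, ENNReal.ofReal_eq_zero, not_le]; linarith
    rw [neg_add, ENNReal.rpow_add _ _ h0 (eA_ne_top _)]
    exact mul_le_mul' (e_anti hp0 (eA_le_eJ u)) (e_anti hq0 ((eA_le_eJ u).trans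
      (ENNReal.ofReal_le_ofReal h)))

lemma tau_int {p q : ℝ} (hp0 : 0 ≤ p) (hq0 : 0 ≤ q) (hp1 : p < 1) (hq1 : q < 1)
    (hpq : 1 < p + q) : ∃ C : ℝ≥0∞, C ≠ ⊤ ∧ ∀ A B : ℝ,
    ∫⁻ t, eJ (t + A) ^ (-p) * eJ (t + B) ^ (-q) ≤ C * eJ (A - B) ^ (-(p + q - 1)) := by
  refine ⟨ENNReal.ofReal ((2 ^ q * (2 / (1 - p)) + 2 / (p + q - 1)))
    + ENNReal.ofReal ((2 ^ p * (2 / (1 - q)) + 2 / (q + p - 1))), by simp, fun A B => ?_⟩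
  set M := jb (A - B) with hM
  have hM0 : 0 < M := jb_pos _
  have e0 : 0 ≤ 2 / (1 - q) := div_nonneg (by norm_num) (by linarith)
  have e1 : 0 ≤ 2 / (1 - p) := div_nonneg (by norm_num) (by linarith)
  have e2 : 0 ≤ 2 / (p + q - 1) := div_nonneg (by norm_num) (by linarith)
  have e3 : 0 ≤ 2 / (q + p - 1) := div_nonneg (by norm_num) (by linarith)
  have hm : MeasurableSet {x : ℝ | |x| ≤ M} := measurableSet_le (by fun_prop) (by fun_prop)
  have hm2 : MeasurableSet {x : ℝ | M < |x|} := measurableSet_lt (by fun_prop) (by fun_prop)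
  have hmeas : ∀ s : ℝ, Measurable (fun x => eA x ^ s) := fun s => measurable_eA.pow_const s
  have h1 := tau_phi hp1 hpq hM0 A
  have h2 := tau_phi hq1 (by linarith : 1 < q + p) hM0 B
  refine le_trans (lintegral_mono (g := fun t => (ENNReal.ofReal ((M / 2) ^ (-q)) *
        ({x : ℝ | |x| ≤ M}.indicator (fun x => eA x ^ (-p)) (t + A))
      + {x : ℝ | M < |x|}.indicator (fun x => eA x ^ (-(p + q))) (t + A)) +
      (ENNReal.ofReal ((M / 2) ^ (-p)) *
        ({x : ℝ | |x| ≤ M}.indicator (fun x => eA x ^ (-q)) (t + B))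
      + {x : ℝ | M < |x|}.indicator (fun x => eA x ^ (-(q + p))) (t + B))) ?_) ?_
  · intro t
    rcases le_total (jb (t + A)) (jb (t + B)) with h | h
    · refine le_trans (tau_pt hp0 hq0 (M := M) ?_ h) le_self_add
      rw [hM]; congr 1; ring
    · beta_reduce
      rw [mul_comm (eJ (t + A) ^ (-p))]
      refine le_trans (tau_pt hq0 hp0 (M := M) ?_ h) le_add_self
      rw [hM]; unfold jb; rw [abs_sub_comm]; congr 2; ring
  · rw [lintegral_add_left]
    · refine le_trans (add_le_add h1 h2) ?_
      rw [ENNReal.ofReal_mul (by positivity), ENNReal.ofReal_mul (by positivity), add_mul]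
      unfold eJ
      rw [ENNReal.ofReal_rpow_of_pos hM0, add_comm q p]
    · have a1 := ((hmeas (-p)).indicator hm).comp (measurable_add_const A)
      have a2 := ((hmeas (-(p+q))).indicator hm2).comp (measurable_add_const A)
      exact (a1.const_mul _).add a2

lemma quad_roots {a m σ : ℝ} (ha : a ≠ 0) : ∃ r₁ r₂ : ℝ, ∀ x : ℝ,
    |a| * (|x - r₁| * |x - r₂|) ≤ |σ - (2 * m * x - a * x ^ 2)| := by
  set k := m / a with hk
  have hm : m = a * k := by rw [hk]; field_simp
  set D := k ^ 2 - σ / a with hD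
  have hσ : σ = a * (k ^ 2 - D) := by rw [hD]; field_simp; ring
  have key : ∀ x, σ - (2 * m * x - a * x ^ 2) = a * ((x - k) ^ 2 - D) := by
    intro x; rw [hσ, hm]; ring
  rcases le_total D 0 with h | h
  · refine ⟨k, k, fun x => ?_⟩
    rw [key, abs_mul, ← abs_mul]
    gcongr |a| * ?_
    rw [← sq, abs_of_nonneg (sq_nonneg _), abs_of_nonneg (by nlinarith [sq_nonneg (x - k)])]
    linarith
  · refine ⟨k + √D, k - √D, fun x => ?_⟩
    rw [key, abs_mul, ← abs_mul]
    gcongr |a| * ?_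
    apply le_of_eq
    congr 1
    have := Real.sq_sqrt h
    linear_combination - this

lemma two_prod (u v : ℝ≥0∞) (s : ℝ) (hs : 0 ≤ s) : u ^ (-s) * v ^ (-s) ≤
    u ^ (-(2 * s)) + v ^ (-(2 * s)) := by
  have h : ∀ w : ℝ≥0∞, w ^ (-(2 * s)) = w ^ (-s) * w ^ (-s) := by
    intro w
    rw [← sq, ← ENNReal.rpow_natCast, ← ENNReal.rpow_mul]; congr 1; push_cast; ring
  rw [h, h]
  rcases le_total u v with h | h
  · exact le_trans (mul_le_mul' le_rfl (e_anti hs h)) le_self_add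
  · exact le_trans (mul_le_mul' (e_anti hs h) le_rfl) le_add_self

lemma key_A {a θ : ℝ} (ha : a ≠ 0) (h0 : 0 ≤ θ) (h1 : θ < 1) (m σ : ℝ) (S : Set ℝ)
    (hS : MeasurableSet S) (hT : ∀ x ∈ S, |2 * m * x - a * x ^ 2| ≤ 3 * jb σ)
    (hd : ∀ x ∈ S, |a| * |x| ≤ 2 * |2 * m - 2 * a * x|)
    (hinj : Set.InjOn (fun x => 2 * m * x - a * x ^ 2) S) :
    ∫⁻ x in S, eA x * eJ (σ - (2 * m * x - a * x ^ 2)) ^ (-θ) ≤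
      ENNReal.ofReal (2 / |a| * ((2 / (1 - θ) + 2) * 3 ^ (1 - θ))) * eJ σ ^ (1 - θ) := by
  have hσ := jb_pos σ
  have ha' : 0 < |a| := abs_pos.2 ha
  have hp : 0 ≤ 2 / (1 - θ) := div_nonneg (by norm_num) (by linarith)
  calc _ ≤ ∫⁻ x in S, ENNReal.ofReal (2 / |a|) * (ENNReal.ofReal |2 * m - 2 * a * x| *
        eJ (σ - (2 * m * x - a * x ^ 2)) ^ (-θ)) := by
        refine setLIntegral_mono' hS fun x hx => ?_
        rw [← mul_assoc, ← ENNReal.ofReal_mul (by positivity)]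
        gcongr
        unfold eA
        apply ENNReal.ofReal_le_ofReal
        have := hd x hx
        rw [div_mul_eq_mul_div, le_div_iff₀ ha']; linarith
    _ = ENNReal.ofReal (2 / |a|) * ∫⁻ x in S, (ENNReal.ofReal |2 * m - 2 * a * x| *
        eJ (σ - (2 * m * x - a * x ^ 2)) ^ (-θ)) := lintegral_const_mul' _ _ (by simp)
    _ = ENNReal.ofReal (2 / |a|) * ∫⁻ t in (fun x => 2 * m * x - a * x ^ 2) '' S,
        eJ (σ - t) ^ (-θ) := by
        congr 1
        rw [lintegral_image_eq_lintegral_abs_deriv_mul hS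
          (f' := fun x => 2 * m - 2 * a * x) _ hinj]
        intro x _
        have : HasDerivAt (fun x : ℝ => 2 * m * x - a * x ^ 2) (2 * m - 2 * a * x) x := by
          have h1 := ((hasDerivAt_id x).const_mul (2 * m)).sub
            (((hasDerivAt_id x).pow 2).const_mul a)
          refine h1.congr_deriv ?_
          simp; ring
        exact this.hasDerivWithinAt
    _ ≤ ENNReal.ofReal (2 / |a|) * ∫⁻ t in Set.Icc (-(3 * jb σ)) (3 * jb σ),
        eA (t - σ) ^ (-θ) := by
        gcongr 1
        refine le_trans (lintegral_mono_set ?_) (lintegral_mono fun t => e_anti h0 ?_)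
        · rintro _ ⟨x, hx, rfl⟩
          exact abs_le.1 (hT x hx)
        · refine le_trans (le_of_eq ?_) (eA_le_eJ _)
          unfold eA; rw [abs_sub_comm]
    _ ≤ ENNReal.ofReal (2 / |a|) *
        ENNReal.ofReal ((2 / (1 - θ) + 2) * (3 * jb σ) ^ (1 - θ)) := by
        gcongr
        refine int_set h0 h1 (by positivity) σ _ ?_
        rw [Real.volume_Icc]; apply ENNReal.ofReal_le_ofReal; linarith
    _ = _ := by
        unfold eJ
        rw [ENNReal.ofReal_rpow_of_pos hσ, ← ENNReal.ofReal_mul (by positivity),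
          ← ENNReal.ofReal_mul (by positivity), Real.mul_rpow (by norm_num) hσ.le]
        congr 1; ring

lemma key_B {a θ : ℝ} (ha : a ≠ 0) (h0 : 0 ≤ θ) (h1 : θ < 1/2) : ∃ C : ℝ≥0∞, C ≠ ⊤ ∧
    ∀ (m σ : ℝ) (S : Set ℝ) (_ : MeasurableSet S)
    (_ : ∀ x ∈ S, |2 * m * x - a * x ^ 2| ≤ 3 * jb σ)
    (_ : ∀ x ∈ S, 2 * |2 * m - 2 * a * x| < |a| * |x|),
    ∫⁻ x in S, eA x * eJ (σ - (2 * m * x - a * x ^ 2)) ^ (-θ) ≤ C * eJ σ ^ (1 - θ) := by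
  refine ⟨ENNReal.ofReal (|a| ^ (-θ) * (2 * ((2 / (1 - 2 * θ) + 2))) * (6 / |a|) ^ (1 - θ)),
    by simp, ?_⟩
  intro m σ S hS hT hd
  have hσ := jb_pos σ
  have ha' : 0 < |a| := abs_pos.2 ha
  have hp : 0 ≤ 2 / (1 - 2 * θ) := div_nonneg (by norm_num) (by linarith)
  obtain ⟨r₁, r₂, hr⟩ := quad_roots (m := m) (σ := σ) ha
  set R := √(6 / |a| * jb σ) with hR
  have hR0 : 0 < R := Real.sqrt_pos.2 (by positivity)
  have hR2 : R ^ 2 = 6 / |a| * jb σ := Real.sq_sqrt (by positivity)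
  have hSR : ∀ x ∈ S, |x| ≤ R := by
    intro x hx
    apply Real.le_sqrt_of_sq_le
    have h2 := hT x hx
    have h3 := hd x hx
    have h4 : |a| * |x| ≤ 2 * |2 * m - a * x| := by
      have : |a| * |x| ≤ |2 * m - a * x| + |2 * m - 2 * a * x| := by
        rw [← abs_mul]
        have := abs_sub (2 * m - a * x) (2 * m - 2 * a * x)
        rwa [show (2 * m - a * x) - (2 * m - 2 * a * x) = a * x by ring] at this
      linarith
    have h5 : |2 * m * x - a * x ^ 2| = |x| * |2 * m - a * x| := by
      rw [← abs_mul]; congr 1; ring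
    rw [div_mul_eq_mul_div, le_div_iff₀ ha']
    nlinarith [mul_le_mul_of_nonneg_left h4 (abs_nonneg x)]
  calc _ ≤ ∫⁻ x in S, ENNReal.ofReal R * (ENNReal.ofReal (|a| ^ (-θ)) *
        (eA (x - r₁) ^ (-(2 * θ)) + eA (x - r₂) ^ (-(2 * θ)))) := by
        refine setLIntegral_mono' hS fun x hx => ?_
        gcongr
        · exact ENNReal.ofReal_le_ofReal (hSR x hx)
        · refine le_trans (e_anti h0 (eA_le_eJ _)) ?_
          refine le_trans (e_anti h0 (ENNReal.ofReal_le_ofReal (hr x))) ?_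
          rw [ENNReal.ofReal_mul (abs_nonneg _), ENNReal.ofReal_mul (abs_nonneg _),
            ENNReal.mul_rpow_of_ne_top (by simp) (by finiteness),
            ENNReal.mul_rpow_of_ne_top (by simp) (by simp),
            ENNReal.ofReal_rpow_of_pos ha']
          gcongr
          exact two_prod _ _ _ h0
    _ = ENNReal.ofReal R * (ENNReal.ofReal (|a| ^ (-θ)) *
        ((∫⁻ x in S, eA (x - r₁) ^ (-(2 * θ))) + (∫⁻ x in S, eA (x - r₂) ^ (-(2 * θ))))) := by
        rw [lintegral_const_mul' _ _ (by simp), lintegral_const_mul' _ _ (by simp),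
          lintegral_add_left (by fun_prop)]
    _ ≤ ENNReal.ofReal R * (ENNReal.ofReal (|a| ^ (-θ)) *
        (ENNReal.ofReal ((2 / (1 - 2 * θ) + 2) * R ^ (1 - 2 * θ)) +
         ENNReal.ofReal ((2 / (1 - 2 * θ) + 2) * R ^ (1 - 2 * θ)))) := by
        have hv : volume S ≤ ENNReal.ofReal (2 * R) := by
          refine le_trans (measure_mono (t := Set.Icc (-R) R) fun x hx => abs_le.1 (hSR x hx)) ?_
          rw [Real.volume_Icc]; apply ENNReal.ofReal_le_ofReal; linarith
        gcongr
        · exact int_set (by linarith) (by linarith) hR0 _ _ hv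
        · exact int_set (by linarith) (by linarith) hR0 _ _ hv
    _ = _ := by
        unfold eJ
        rw [ENNReal.ofReal_rpow_of_pos hσ, ← ENNReal.ofReal_add (by positivity) (by positivity),
          ← ENNReal.ofReal_mul (by positivity), ← ENNReal.ofReal_mul (by positivity),
          ← ENNReal.ofReal_mul (by positivity)]
        congr 1
        have e1 : R * R ^ (1 - 2 * θ) = (6 / |a|) ^ (1 - θ) * jb σ ^ (1 - θ) := by
          rw [← Real.mul_rpow (by positivity) hσ.le, ← hR2, ← Real.rpow_natCast,
            ← Real.rpow_mul hR0.le]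
          nth_rewrite 1 [← Real.rpow_one R]
          rw [← Real.rpow_add hR0]
          congr 1; push_cast; ring
        linear_combination (|a| ^ (-θ) * (2 * ((2 / (1 - 2 * θ) + 2)))) * e1

lemma key_int {a θ : ℝ} (ha : a ≠ 0) (h0 : 0 ≤ θ) (h1 : θ < 1/2) : ∃ C : ℝ≥0∞, C ≠ ⊤ ∧
    ∀ (m σ : ℝ), ∫⁻ x in {x : ℝ | |2 * m * x - a * x ^ 2| ≤ 3 * jb σ},
      eA x * eJ (σ - (2 * m * x - a * x ^ 2)) ^ (-θ) ≤ C * eJ σ ^ (1 - θ) := by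
  obtain ⟨C, hC, hB⟩ := key_B ha h0 h1
  set D := ENNReal.ofReal (2 / |a| * ((2 / (1 - θ) + 2) * 3 ^ (1 - θ))) with hD
  refine ⟨(D + D) + C, by simp [hC, hD], fun m σ => ?_⟩
  set T := {x : ℝ | |2 * m * x - a * x ^ 2| ≤ 3 * jb σ} with hT
  have hTm : MeasurableSet T := measurableSet_le (by fun_prop) (by fun_prop)
  set U := {x : ℝ | |a| * |x| ≤ 2 * |2 * m - 2 * a * x|} with hU
  have hUm : MeasurableSet U := measurableSet_le (by fun_prop) (by fun_prop)
  set k := m / a with hk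
  have hm : m = a * k := by rw [hk]; field_simp
  have hinj : ∀ x y : ℝ, 2 * m * x - a * x ^ 2 = 2 * m * y - a * y ^ 2 →
      x = y ∨ x + y = 2 * k := by
    intro x y h
    rw [hm] at h
    have : a * ((x - y) * (2 * k - (x + y))) = 0 := by linear_combination h
    rcases mul_eq_zero.1 ((mul_eq_zero.1 this).resolve_left ha) with h | h
    · left; linarith
    · right; linarith
  have hA1 := key_A ha h0 (by linarith) m σ (T ∩ U ∩ Set.Iic k)
    ((hTm.inter hUm).inter measurableSet_Iic) (fun x hx => hx.1.1) (fun x hx => hx.1.2) (by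
      intro x hx y hy h
      have hx2 : x ≤ k := hx.2
      have hy2 : y ≤ k := hy.2
      rcases hinj x y h with h | h <;> linarith)
  have hA2 := key_A ha h0 (by linarith) m σ (T ∩ U ∩ Set.Ioi k)
    ((hTm.inter hUm).inter measurableSet_Ioi) (fun x hx => hx.1.1) (fun x hx => hx.1.2) (by
      intro x hx y hy h
      have hx2 : k < x := hx.2
      have hy2 : k < y := hy.2
      rcases hinj x y h with h | h <;> linarith)
  have hB1 := hB m σ (T \ U) (hTm.diff hUm) (fun x hx => hx.1) (fun x hx => not_le.1 hx.2)
  have hsub : T ⊆ ((T ∩ U ∩ Set.Iic k) ∪ (T ∩ U ∩ Set.Ioi k)) ∪ (T \ U) := by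
    intro x hx
    by_cases hxU : x ∈ U
    · left
      rcases le_or_gt x k with h | h
      · left; exact ⟨⟨hx, hxU⟩, h⟩
      · right; exact ⟨⟨hx, hxU⟩, h⟩
    · right; exact ⟨hx, hxU⟩
  refine le_trans (lintegral_mono_set hsub) ?_
  refine le_trans (lintegral_union_le _ _ _) ?_
  rw [add_mul, add_mul]
  refine add_le_add ?_ hB1
  refine le_trans (lintegral_union_le _ _ _) ?_
  exact add_le_add hA1 hA2

lemma meas_or {α : Type*} [MeasurableSpace α] {p q : α → Prop} (hp : MeasurableSet {x | p x})
    (hq : MeasurableSet {x | q x}) : MeasurableSet {x | p x ∨ q x} := by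
  have h := hp.union hq
  convert h using 1
  ext x; simp

lemma meas_and {α : Type*} [MeasurableSpace α] {p q : α → Prop} (hp : MeasurableSet {x | p x})
    (hq : MeasurableSet {x | q x}) : MeasurableSet {x | p x ∧ q x} := by
  have h := hp.inter hq
  convert h using 1
  ext x; simp

lemma eJ_le_two_eA {x : ℝ} (hx : 1 ≤ |x|) : eJ x ≤ 2 * eA x := by
  unfold eJ eA jb
  rw [show (2:ℝ≥0∞) = ENNReal.ofReal 2 by simp, ← ENNReal.ofReal_mul (by norm_num)]
  exact ENNReal.ofReal_le_ofReal (by linarith)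

lemma eJ_neg_le_one (x : ℝ) {s : ℝ} (hs : 0 ≤ s) : eJ x ^ (-s) ≤ 1 := by
  have := e_anti hs (one_le_eJ x)
  simpa using this

lemma xi_int {γ θ : ℝ} (hγ : |γ| ≠ 1) (h0 : 0 ≤ θ) (h1 : θ < 1/2) : ∃ C : ℝ≥0∞, C ≠ ⊤ ∧
    ∀ (m σ : ℝ), ∫⁻ x in {x : ℝ | |x| ≤ 1 ∨ |2 * m * x - x ^ 2 - γ * |x| * x| ≤ 3 * jb σ},
      eJ x * eJ (σ - (2 * m * x - x ^ 2 - γ * |x| * x)) ^ (-θ) ≤ C * eJ σ ^ (1 - θ) := by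
  have hp : 1 + γ ≠ 0 := by
    intro h; apply hγ; rw [show γ = -1 by linarith]; simp
  have hq : 1 - γ ≠ 0 := by
    intro h; apply hγ; rw [show γ = 1 by linarith]; simp
  obtain ⟨C1, hC1, hB1⟩ := key_int hp h0 h1
  obtain ⟨C2, hC2, hB2⟩ := key_int hq h0 h1
  refine ⟨(4 + 2 * C1) + 2 * C2, by finiteness, fun m σ => ?_⟩
  set S0 := Set.Icc (-1:ℝ) 1 with hS0
  set S1 := {x : ℝ | 1 ≤ x ∧ |2 * m * x - (1 + γ) * x ^ 2| ≤ 3 * jb σ} with hS1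
  set S2 := {x : ℝ | x ≤ -1 ∧ |2 * m * x - (1 - γ) * x ^ 2| ≤ 3 * jb σ} with hS2
  have hm1 : MeasurableSet S1 := meas_and (measurableSet_le (by fun_prop) (by fun_prop))
    (measurableSet_le (by fun_prop) (by fun_prop))
  have hm2 : MeasurableSet S2 := meas_and (measurableSet_le (by fun_prop) (by fun_prop))
    (measurableSet_le (by fun_prop) (by fun_prop))
  have hpos : ∀ x : ℝ, 0 ≤ x → 2 * m * x - x ^ 2 - γ * |x| * x = 2 * m * x - (1 + γ) * x ^ 2 := by
    intro x hx; rw [abs_of_nonneg hx]; ring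
  have hneg : ∀ x : ℝ, x ≤ 0 → 2 * m * x - x ^ 2 - γ * |x| * x = 2 * m * x - (1 - γ) * x ^ 2 := by
    intro x hx; rw [abs_of_nonpos hx]; ring
  have hsub : {x : ℝ | |x| ≤ 1 ∨ |2 * m * x - x ^ 2 - γ * |x| * x| ≤ 3 * jb σ} ⊆
      (S0 ∪ S1) ∪ S2 := by
    rintro x (hx | hx)
    · left; left; exact abs_le.1 hx
    · rcases le_total x (-1) with h | h
      · right; rw [hneg x (by linarith)] at hx; exact ⟨h, hx⟩
      · rcases le_total 1 x with h' | h'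
        · left; right; rw [hpos x (by linarith)] at hx; exact ⟨h', hx⟩
        · left; left; exact ⟨h, h'⟩
  refine le_trans (lintegral_mono_set hsub) ?_
  refine le_trans (lintegral_union_le _ _ _) ?_
  refine le_trans (add_le_add (lintegral_union_le _ _ _) le_rfl) ?_
  rw [add_mul, add_mul]
  refine add_le_add (add_le_add ?_ ?_) ?_
  · calc _ ≤ ∫⁻ x in S0, (2:ℝ≥0∞) := by
          refine setLIntegral_mono' measurableSet_Icc fun x hx => ?_
          refine le_trans (mul_le_mul' (b := (2:ℝ≥0∞)) ?_ (eJ_neg_le_one _ h0)) (by simp)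
          unfold eJ jb
          rw [show (2:ℝ≥0∞) = ENNReal.ofReal 2 by simp]
          exact ENNReal.ofReal_le_ofReal (by linarith [abs_le.2 hx])
      _ ≤ 4 * 1 := by
          rw [setLIntegral_const, Real.volume_Icc]
          norm_num
      _ ≤ _ := by
          gcongr
          have := ENNReal.rpow_le_rpow (one_le_eJ σ) (by linarith : 0 ≤ 1 - θ)
          simpa using this
  · calc _ ≤ ∫⁻ x in S1, 2 * (eA x * eJ (σ - (2 * m * x - (1 + γ) * x ^ 2)) ^ (-θ)) := by
          refine setLIntegral_mono' hm1 fun x hx => ?_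
          have hx1 : 1 ≤ x := hx.1
          rw [hpos x (by linarith), ← mul_assoc]
          gcongr
          exact eJ_le_two_eA (hx1.trans (le_abs_self x))
      _ = 2 * ∫⁻ x in S1, (eA x * eJ (σ - (2 * m * x - (1 + γ) * x ^ 2)) ^ (-θ)) :=
          lintegral_const_mul' _ _ (by simp)
      _ ≤ 2 * (C1 * eJ σ ^ (1 - θ)) := by
          gcongr 1
          exact le_trans (lintegral_mono_set fun x hx => hx.2) (hB1 m σ)
      _ = _ := by ring
  · calc _ ≤ ∫⁻ x in S2, 2 * (eA x * eJ (σ - (2 * m * x - (1 - γ) * x ^ 2)) ^ (-θ)) := by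
          refine setLIntegral_mono' hm2 fun x hx => ?_
          have hx1 : x ≤ -1 := hx.1
          rw [hneg x (by linarith), ← mul_assoc]
          gcongr
          exact eJ_le_two_eA (by linarith [neg_le_abs x])
      _ = 2 * ∫⁻ x in S2, (eA x * eJ (σ - (2 * m * x - (1 - γ) * x ^ 2)) ^ (-θ)) :=
          lintegral_const_mul' _ _ (by simp)
      _ ≤ 2 * (C2 * eJ σ ^ (1 - θ)) := by
          gcongr 1
          exact le_trans (lintegral_mono_set fun x hx => hx.2) (hB2 m σ)
      _ = _ := by ring

lemma lin_int {θ x : ℝ} (h0 : 0 ≤ θ) (h1 : θ < 1) (hx : 1 ≤ |x|) (n σ : ℝ) :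
    eJ x * ∫⁻ ξ in {ξ : ℝ | |2 * ξ * x - n| ≤ 3 * jb σ}, eJ (σ + (2 * ξ * x - n)) ^ (-θ) ≤
      ENNReal.ofReal ((2 / (1 - θ) + 2) * 3 ^ (1 - θ)) * eJ σ ^ (1 - θ) := by
  have hσ := jb_pos σ
  have hx0 : 0 < |x| := by linarith
  have hxne : x ≠ 0 := abs_pos.1 hx0
  have hp : 0 ≤ 2 / (1 - θ) := div_nonneg (by norm_num) (by linarith)
  set R := 3 * jb σ / (2 * |x|) with hR
  have hR0 : 0 < R := by positivity
  set S := {ξ : ℝ | |2 * ξ * x - n| ≤ 3 * jb σ}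
  have hv : volume S ≤ ENNReal.ofReal (2 * R) := by
    have hs : S ⊆ Set.Icc (n / (2 * x) - R) (n / (2 * x) + R) := by
      intro ξ hξ
      have h2 : |ξ - n / (2 * x)| ≤ R := by
        have : ξ - n / (2 * x) = (2 * ξ * x - n) / (2 * x) := by field_simp
        rw [this, abs_div, hR, abs_mul, abs_two]
        gcongr
        exact hξ
      have := abs_le.1 h2
      constructor <;> linarith
    refine le_trans (measure_mono hs) ?_
    rw [Real.volume_Icc]; apply ENNReal.ofReal_le_ofReal; linarith
  have hI := int_set h0 h1 hR0 ((n - σ) / (2 * x)) S hv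
  calc _ ≤ ENNReal.ofReal (2 * |x|) * ∫⁻ ξ in S, ENNReal.ofReal ((2 * |x|) ^ (-θ)) *
        eA (ξ - (n - σ) / (2 * x)) ^ (-θ) := by
        gcongr
        · unfold eJ jb; exact ENNReal.ofReal_le_ofReal (by linarith)
        · refine le_trans (e_anti h0 (eA_le_eJ _)) ?_
          rw [← ENNReal.ofReal_rpow_of_pos (by positivity),
            ← ENNReal.mul_rpow_of_ne_top ENNReal.ofReal_ne_top (eA_ne_top _)]
          apply le_of_eq
          congr 1
          unfold eA
          rw [← ENNReal.ofReal_mul (by positivity)]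
          congr 1
          rw [show 2 * |x| = |2 * x| by rw [abs_mul, abs_two], ← abs_mul]
          congr 1
          field_simp
          ring
    _ = ENNReal.ofReal (2 * |x|) * (ENNReal.ofReal ((2 * |x|) ^ (-θ)) * ∫⁻ ξ in S,
        eA (ξ - (n - σ) / (2 * x)) ^ (-θ)) := by
        rw [lintegral_const_mul' _ _ (by simp)]
    _ ≤ ENNReal.ofReal (2 * |x|) * (ENNReal.ofReal ((2 * |x|) ^ (-θ)) *
        ENNReal.ofReal ((2 / (1 - θ) + 2) * R ^ (1 - θ))) := by gcongr
    _ = _ := by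
        unfold eJ
        rw [ENNReal.ofReal_rpow_of_pos hσ, ← ENNReal.ofReal_mul (by positivity),
          ← ENNReal.ofReal_mul (by positivity), ← ENNReal.ofReal_mul (by positivity)]
        congr 1
        have e1 : (2 * |x|) * ((2 * |x|) ^ (-θ) * R ^ (1 - θ)) = 3 ^ (1 - θ) * jb σ ^ (1 - θ) := by
          rw [← mul_assoc]
          nth_rewrite 1 [← Real.rpow_one (2 * |x|)]
          rw [← Real.rpow_add (by positivity), ← sub_eq_add_neg,
            ← Real.mul_rpow (by positivity) hR0.le, ← Real.mul_rpow (by positivity) hσ.le, hR]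
          congr 1
          field_simp
        linear_combination (2 / (1 - θ) + 2) * e1

lemma ind_le {S : Set ℝ} (hS : MeasurableSet S) (F : ℝ → ℝ≥0∞) :
    ∫⁻ x, S.indicator 1 x * F x = ∫⁻ x in S, F x := by
  rw [← lintegral_indicator hS]
  congr 1; ext x
  by_cases hx : x ∈ S <;> simp [hx]

lemma eJ_cancel (σ c : ℝ) : eJ σ ^ (-(2 * c)) * eJ σ ^ (1 - (1 - 2 * c)) = 1 := by
  rw [← ENNReal.rpow_add _ _ (eJ_ne_zero _) (eJ_ne_top _)]
  simp

lemma eJ_neg (x : ℝ) : eJ (-x) = eJ x := by unfold eJ jb; rw [abs_neg]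

/-- combine the time integral with monotonicity of exponents -/
lemma tau_use {p q r : ℝ} (hp : p ∈ Set.Ioo (1/4 : ℝ) (1/2)) (hq : q ∈ Set.Ioo (1/4 : ℝ) (1/2))
    (hsum : 1 ≤ p + q + r) : ∃ C : ℝ≥0∞, C ≠ ⊤ ∧ ∀ A B : ℝ,
    ∫⁻ t, eJ (t + A) ^ (-(2 * p)) * eJ (t + B) ^ (-(2 * q)) ≤
      C * eJ (A - B) ^ (-(1 - 2 * r)) := by
  obtain ⟨hp1, hp2⟩ := hp
  obtain ⟨hq1, hq2⟩ := hq
  obtain ⟨C, hC, h⟩ := tau_int (p := 2 * p) (q := 2 * q) (by linarith) (by linarith) (by linarith)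
    (by linarith) (by linarith)
  refine ⟨C, hC, fun A B => (h A B).trans ?_⟩
  gcongr 1
  exact ENNReal.rpow_le_rpow_of_exponent_le (one_le_eJ _) (by linarith)

lemma sup_one (γ b b₁ c₁ : ℝ) (hγ1 : |γ| ≠ 1)
    (hb : b ∈ Set.Ioo (1/4 : ℝ) (1/2)) (hb₁ : b₁ ∈ Set.Ioo (1/4 : ℝ) (1/2))
    (hc₁ : c₁ ∈ Set.Ioo (1/4 : ℝ) (1/2)) (hsum : 1 ≤ b + b₁ + c₁) :
    ∃ C : ℝ≥0∞, C ≠ ⊤ ∧ ∀ τ ξ : ℝ, ∫⁻ x, ∫⁻ t,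
      {x : ℝ | |x| ≤ 1 ∨ |2 * ξ * x - x ^ 2 - γ * |x| * x| ≤ 3 * jb (τ + ξ ^ 2)}.indicator 1 x *
      (eJ x * eJ (τ + ξ ^ 2) ^ (-(2 * c₁)) * eJ (t + γ * |x| * x) ^ (-(2 * b)) *
        eJ (τ - t + (ξ - x) ^ 2) ^ (-(2 * b₁))) ≤ C := by
  obtain ⟨C1, hC1, H1⟩ := tau_use hb hb₁ hsum
  obtain ⟨C2, hC2, H2⟩ := xi_int (θ := 1 - 2 * c₁) hγ1 (by linarith [hc₁.2]) (by linarith [hc₁.1])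
  refine ⟨C1 * C2, ENNReal.mul_ne_top hC1 hC2, fun τ ξ => ?_⟩
  set S := {x : ℝ | |x| ≤ 1 ∨ |2 * ξ * x - x ^ 2 - γ * |x| * x| ≤ 3 * jb (τ + ξ ^ 2)} with hS
  have hSm : MeasurableSet S := meas_or (measurableSet_le (by fun_prop) (by fun_prop))
    (measurableSet_le (by fun_prop) (by fun_prop))
  set σ := τ + ξ ^ 2 with hσ
  calc _ ≤ ∫⁻ x, (C1 * eJ σ ^ (-(2 * c₁))) * (S.indicator 1 x * (eJ x *
        eJ (σ - (2 * ξ * x - x ^ 2 - γ * |x| * x)) ^ (-(1 - 2 * c₁)))) := by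
        refine lintegral_mono fun x => ?_
        calc _ = ∫⁻ t, (S.indicator 1 x * eJ x * eJ σ ^ (-(2 * c₁))) *
              (eJ (t + γ * |x| * x) ^ (-(2 * b)) * eJ (t + (-(τ + (ξ - x) ^ 2))) ^ (-(2 * b₁))) := by
              refine lintegral_congr fun t => ?_
              rw [← eJ_neg (t + (-(τ + (ξ - x) ^ 2))),
                show -(t + (-(τ + (ξ - x) ^ 2))) = τ - t + (ξ - x) ^ 2 by ring]
              ring
          _ = (S.indicator 1 x * eJ x * eJ σ ^ (-(2 * c₁))) * ∫⁻ t,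
              (eJ (t + γ * |x| * x) ^ (-(2 * b)) * eJ (t + (-(τ + (ξ - x) ^ 2))) ^ (-(2 * b₁))) :=
              lintegral_const_mul _ (by fun_prop)
          _ ≤ (S.indicator 1 x * eJ x * eJ σ ^ (-(2 * c₁))) * (C1 *
              eJ (γ * |x| * x - (-(τ + (ξ - x) ^ 2))) ^ (-(1 - 2 * c₁))) := by
              gcongr 1
              exact H1 _ _
          _ = _ := by
              rw [show γ * |x| * x - (-(τ + (ξ - x) ^ 2)) =
                σ - (2 * ξ * x - x ^ 2 - γ * |x| * x) by rw [hσ]; ring]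
              ring
    _ = (C1 * eJ σ ^ (-(2 * c₁))) * ∫⁻ x in S, (eJ x *
        eJ (σ - (2 * ξ * x - x ^ 2 - γ * |x| * x)) ^ (-(1 - 2 * c₁))) := by
        rw [lintegral_const_mul, ind_le hSm]
        refine Measurable.mul (measurable_one.indicator hSm) (by fun_prop)
    _ ≤ (C1 * eJ σ ^ (-(2 * c₁))) * (C2 * eJ σ ^ (1 - (1 - 2 * c₁))) := by
        gcongr 1
        exact H2 ξ σ
    _ = C1 * C2 * (eJ σ ^ (-(2 * c₁)) * eJ σ ^ (1 - (1 - 2 * c₁))) := by ring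
    _ = _ := by rw [eJ_cancel, mul_one]

lemma sup_three (γ b b₁ c₁ : ℝ) (hγ1 : |γ| ≠ 1)
    (hb : b ∈ Set.Ioo (1/4 : ℝ) (1/2)) (hb₁ : b₁ ∈ Set.Ioo (1/4 : ℝ) (1/2))
    (hc₁ : c₁ ∈ Set.Ioo (1/4 : ℝ) (1/2)) (hsum : 1 ≤ b + b₁ + c₁) :
    ∃ C : ℝ≥0∞, C ≠ ⊤ ∧ ∀ τ ξ : ℝ, ∫⁻ x, ∫⁻ t,
      {x : ℝ | |x| ≤ 1 ∨ |2 * ξ * x + x ^ 2 - γ * |x| * x| ≤ 3 * jb (τ + ξ ^ 2)}.indicator 1 x *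
      (eJ x * eJ (τ + t + (ξ + x) ^ 2) ^ (-(2 * c₁)) * eJ (t + γ * |x| * x) ^ (-(2 * b)) *
        eJ (τ + ξ ^ 2) ^ (-(2 * b₁))) ≤ C := by
  obtain ⟨C1, hC1, H1⟩ := tau_use (r := b₁) hc₁ hb (by linarith)
  obtain ⟨C2, hC2, H2⟩ := xi_int (γ := -γ) (θ := 1 - 2 * b₁) (by rwa [abs_neg])
    (by linarith [hb₁.2]) (by linarith [hb₁.1])
  refine ⟨C1 * C2, ENNReal.mul_ne_top hC1 hC2, fun τ ξ => ?_⟩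
  have hSeq : {x : ℝ | |x| ≤ 1 ∨ |2 * ξ * x + x ^ 2 - γ * |x| * x| ≤ 3 * jb (τ + ξ ^ 2)} =
    {x : ℝ | |x| ≤ 1 ∨ |2 * (-ξ) * x - x ^ 2 - (-γ) * |x| * x| ≤ 3 * jb (τ + ξ ^ 2)} := by
    ext x
    simp only [Set.mem_ofPred_eq]
    rw [← abs_neg (2 * ξ * x + x ^ 2 - γ * |x| * x),
      show -(2 * ξ * x + x ^ 2 - γ * |x| * x) = 2 * (-ξ) * x - x ^ 2 - (-γ) * |x| * x by ring]
  rw [hSeq]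
  set S := {x : ℝ | |x| ≤ 1 ∨ |2 * (-ξ) * x - x ^ 2 - (-γ) * |x| * x| ≤ 3 * jb (τ + ξ ^ 2)} with hS
  have hSm : MeasurableSet S := meas_or (measurableSet_le (by fun_prop) (by fun_prop))
    (measurableSet_le (by fun_prop) (by fun_prop))
  set σ := τ + ξ ^ 2 with hσ
  calc _ ≤ ∫⁻ x, (C1 * eJ σ ^ (-(2 * b₁))) * (S.indicator 1 x * (eJ x *
        eJ (σ - (2 * (-ξ) * x - x ^ 2 - (-γ) * |x| * x)) ^ (-(1 - 2 * b₁)))) := by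
        refine lintegral_mono fun x => ?_
        calc _ = ∫⁻ t, (S.indicator 1 x * eJ x * eJ σ ^ (-(2 * b₁))) *
              (eJ (t + (τ + (ξ + x) ^ 2)) ^ (-(2 * c₁)) * eJ (t + γ * |x| * x) ^ (-(2 * b))) := by
              refine lintegral_congr fun t => ?_
              rw [show t + (τ + (ξ + x) ^ 2) = τ + t + (ξ + x) ^ 2 by ring]
              ring
          _ = (S.indicator 1 x * eJ x * eJ σ ^ (-(2 * b₁))) * ∫⁻ t,
              (eJ (t + (τ + (ξ + x) ^ 2)) ^ (-(2 * c₁)) * eJ (t + γ * |x| * x) ^ (-(2 * b))) :=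
              lintegral_const_mul _ (by fun_prop)
          _ ≤ (S.indicator 1 x * eJ x * eJ σ ^ (-(2 * b₁))) * (C1 *
              eJ ((τ + (ξ + x) ^ 2) - γ * |x| * x) ^ (-(1 - 2 * b₁))) := by
              gcongr 1
              exact H1 _ _
          _ = _ := by
              rw [show (τ + (ξ + x) ^ 2) - γ * |x| * x =
                σ - (2 * (-ξ) * x - x ^ 2 - (-γ) * |x| * x) by rw [hσ]; ring]
              ring
    _ = (C1 * eJ σ ^ (-(2 * b₁))) * ∫⁻ x in S, (eJ x *
        eJ (σ - (2 * (-ξ) * x - x ^ 2 - (-γ) * |x| * x)) ^ (-(1 - 2 * b₁))) := by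
        rw [lintegral_const_mul, ind_le hSm]
        refine Measurable.mul (measurable_one.indicator hSm) (by fun_prop)
    _ ≤ (C1 * eJ σ ^ (-(2 * b₁))) * (C2 * eJ σ ^ (1 - (1 - 2 * b₁))) := by
        gcongr 1
        exact H2 (-ξ) σ
    _ = C1 * C2 * (eJ σ ^ (-(2 * b₁)) * eJ σ ^ (1 - (1 - 2 * b₁))) := by ring
    _ = _ := by rw [eJ_cancel, mul_one]

lemma sup_two (γ b b₁ c₁ : ℝ)
    (hb : b ∈ Set.Ioo (1/4 : ℝ) (1/2)) (hb₁ : b₁ ∈ Set.Ioo (1/4 : ℝ) (1/2))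
    (hc₁ : c₁ ∈ Set.Ioo (1/4 : ℝ) (1/2)) (hsum : 1 ≤ b + b₁ + c₁) :
    ∃ C : ℝ≥0∞, C ≠ ⊤ ∧ ∀ t x : ℝ, ∫⁻ ξ, ∫⁻ τ,
      {ξ : ℝ | 1 ≤ |x| ∧ |2 * ξ * x - x ^ 2 - γ * |x| * x| ≤
        3 * jb (t + γ * |x| * x)}.indicator 1 ξ *
      (eJ x * eJ (τ + ξ ^ 2) ^ (-(2 * c₁)) * eJ (t + γ * |x| * x) ^ (-(2 * b)) *
        eJ (τ - t + (ξ - x) ^ 2) ^ (-(2 * b₁))) ≤ C := by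
  obtain ⟨C1, hC1, H1⟩ := tau_use (r := b) hc₁ hb₁ (by linarith)
  set C2 := ENNReal.ofReal ((2 / (1 - (1 - 2 * b)) + 2) * 3 ^ (1 - (1 - 2 * b))) with hC2
  refine ⟨C1 * C2, ENNReal.mul_ne_top hC1 (by simp [hC2]), fun t x => ?_⟩
  by_cases hx : 1 ≤ |x|
  swap
  · simp [hx]
  have hSeq : {ξ : ℝ | 1 ≤ |x| ∧ |2 * ξ * x - x ^ 2 - γ * |x| * x| ≤ 3 * jb (t + γ * |x| * x)} =
    {ξ : ℝ | |2 * ξ * x - (x ^ 2 + γ * |x| * x)| ≤ 3 * jb (t + γ * |x| * x)} := by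
    ext ξ
    simp only [Set.mem_ofPred_eq, hx, true_and]
    rw [sub_sub]
  rw [hSeq]
  set σ := t + γ * |x| * x with hσ
  set S := {ξ : ℝ | |2 * ξ * x - (x ^ 2 + γ * |x| * x)| ≤ 3 * jb σ} with hS
  have hSm : MeasurableSet S := measurableSet_le (by fun_prop) (by fun_prop)
  calc _ ≤ ∫⁻ ξ, (C1 * eJ x * eJ σ ^ (-(2 * b))) * (S.indicator 1 ξ *
        eJ (σ + (2 * ξ * x - (x ^ 2 + γ * |x| * x))) ^ (-(1 - 2 * b))) := by
        refine lintegral_mono fun ξ => ?_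
        calc _ = ∫⁻ τ, (S.indicator 1 ξ * eJ x * eJ σ ^ (-(2 * b))) *
              (eJ (τ + ξ ^ 2) ^ (-(2 * c₁)) * eJ (τ + (-t + (ξ - x) ^ 2)) ^ (-(2 * b₁))) := by
              refine lintegral_congr fun τ => ?_
              rw [show τ + (-t + (ξ - x) ^ 2) = τ - t + (ξ - x) ^ 2 by ring]
              ring
          _ = (S.indicator 1 ξ * eJ x * eJ σ ^ (-(2 * b))) * ∫⁻ τ,
              (eJ (τ + ξ ^ 2) ^ (-(2 * c₁)) * eJ (τ + (-t + (ξ - x) ^ 2)) ^ (-(2 * b₁))) :=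
              lintegral_const_mul _ (by fun_prop)
          _ ≤ (S.indicator 1 ξ * eJ x * eJ σ ^ (-(2 * b))) * (C1 *
              eJ (ξ ^ 2 - (-t + (ξ - x) ^ 2)) ^ (-(1 - 2 * b))) := by
              gcongr 1
              exact H1 _ _
          _ = _ := by
              rw [show ξ ^ 2 - (-t + (ξ - x) ^ 2) =
                σ + (2 * ξ * x - (x ^ 2 + γ * |x| * x)) by rw [hσ]; ring]
              ring
    _ = (C1 * eJ x * eJ σ ^ (-(2 * b))) * ∫⁻ ξ in S,
        eJ (σ + (2 * ξ * x - (x ^ 2 + γ * |x| * x))) ^ (-(1 - 2 * b)) := by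
        rw [lintegral_const_mul, ind_le hSm]
        refine Measurable.mul (measurable_one.indicator hSm) (by fun_prop)
    _ = (C1 * eJ σ ^ (-(2 * b))) * (eJ x * ∫⁻ ξ in S,
        eJ (σ + (2 * ξ * x - (x ^ 2 + γ * |x| * x))) ^ (-(1 - 2 * b))) := by ring
    _ ≤ (C1 * eJ σ ^ (-(2 * b))) * (C2 * eJ σ ^ (1 - (1 - 2 * b))) := by
        gcongr 1
        exact lin_int (by linarith [hb.2]) (by linarith [hb.1]) hx _ σ
    _ = C1 * C2 * (eJ σ ^ (-(2 * b)) * eJ σ ^ (1 - (1 - 2 * b))) := by ring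
    _ = _ := by rw [eJ_cancel, mul_one]

/-- Cauchy-Schwarz -/
lemma cs {α : Type*} [MeasurableSpace α] (μ : Measure α) {G P : α → ℝ≥0∞} (hG : Measurable G)
    (hP : Measurable P) : ∫⁻ q, G q * P q ∂μ ≤
      (∫⁻ q, G q ^ 2 ∂μ) ^ (1/2 : ℝ) * (∫⁻ q, P q ^ 2 ∂μ) ^ (1/2 : ℝ) := by
  have h := ENNReal.lintegral_mul_le_Lp_mul_Lq μ Real.HolderConjugate.two_two hG.aemeasurable
    hP.aemeasurable
  simpa using h

/-- `L²` norm of an extended nonnegative function. -/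
noncomputable def eN (F : ℝ × ℝ → ℝ≥0∞) : ℝ≥0∞ := (∫⁻ p, F p ^ 2) ^ (1/2 : ℝ)

lemma split_half (A B : ℝ≥0∞) : (A * B) ^ (1/2 : ℝ) = A ^ (1/2 : ℝ) * B ^ (1/2 : ℝ) :=
  ENNReal.mul_rpow_of_nonneg _ _ (by norm_num)

section tri

variable {f g h : ℝ × ℝ → ℝ≥0∞} {K : (ℝ × ℝ) × ℝ × ℝ → ℝ≥0∞} {C : ℝ≥0∞}

lemma vol4 : (volume : Measure ((ℝ × ℝ) × ℝ × ℝ)) =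
    (volume : Measure (ℝ × ℝ)).prod (volume : Measure (ℝ × ℝ)) := rfl

lemma tri_one (hf : Measurable f) (hg : Measurable g) (hh : Measurable h) (hK : Measurable K)
    (hC : ∀ p, ∫⁻ y, K (p, y) ^ 2 ≤ C) :
    ∫⁻ q : (ℝ × ℝ) × ℝ × ℝ, (f q.2 * g (q.1 - q.2)) * (h q.1 * K q) ≤
      C ^ (1/2 : ℝ) * (eN f * eN g * eN h) := by
  refine (cs _ (by fun_prop) (by fun_prop)).trans ?_
  have e1 : ∫⁻ q : (ℝ × ℝ) × ℝ × ℝ, (f q.2 * g (q.1 - q.2)) ^ 2 =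
      (∫⁻ p, f p ^ 2) * ∫⁻ p, g p ^ 2 := by
    rw [vol4, lintegral_prod_symm _ (by fun_prop), ← lintegral_mul_const _ (by fun_prop)]
    refine lintegral_congr fun y => ?_
    simp only [mul_pow]
    rw [lintegral_const_mul _ (by fun_prop),
      lintegral_sub_right_eq_self (fun x => g x ^ 2) y]
  have e2 : ∫⁻ q : (ℝ × ℝ) × ℝ × ℝ, (h q.1 * K q) ^ 2 ≤ C * ∫⁻ p, h p ^ 2 := by
    rw [vol4, lintegral_prod _ (by fun_prop), ← lintegral_const_mul _ (by fun_prop)]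
    refine lintegral_mono fun x => ?_
    simp only [mul_pow]
    rw [lintegral_const_mul _ (by fun_prop), mul_comm]
    gcongr
    exact hC x
  rw [e1, split_half]
  refine (mul_le_mul' le_rfl (ENNReal.rpow_le_rpow e2 (by norm_num))).trans (le_of_eq ?_)
  rw [split_half]
  unfold eN
  ring

lemma tri_two (hf : Measurable f) (hg : Measurable g) (hh : Measurable h) (hK : Measurable K)
    (hC : ∀ p, ∫⁻ y, K (y, p) ^ 2 ≤ C) :
    ∫⁻ q : (ℝ × ℝ) × ℝ × ℝ, (h q.1 * g (q.1 - q.2)) * (f q.2 * K q) ≤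
      C ^ (1/2 : ℝ) * (eN f * eN g * eN h) := by
  refine (cs _ (by fun_prop) (by fun_prop)).trans ?_
  have e1 : ∫⁻ q : (ℝ × ℝ) × ℝ × ℝ, (h q.1 * g (q.1 - q.2)) ^ 2 =
      (∫⁻ p, h p ^ 2) * ∫⁻ p, g p ^ 2 := by
    rw [vol4, lintegral_prod _ (by fun_prop), ← lintegral_mul_const _ (by fun_prop)]
    refine lintegral_congr fun y => ?_
    simp only [mul_pow]
    rw [lintegral_const_mul _ (by fun_prop),
      lintegral_sub_left_eq_self (fun x => g x ^ 2) y]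
  have e2 : ∫⁻ q : (ℝ × ℝ) × ℝ × ℝ, (f q.2 * K q) ^ 2 ≤ C * ∫⁻ p, f p ^ 2 := by
    rw [vol4, lintegral_prod_symm _ (by fun_prop), ← lintegral_const_mul _ (by fun_prop)]
    refine lintegral_mono fun x => ?_
    simp only [mul_pow]
    rw [lintegral_const_mul _ (by fun_prop), mul_comm]
    gcongr
    exact hC x
  rw [e1, split_half]
  refine (mul_le_mul' le_rfl (ENNReal.rpow_le_rpow e2 (by norm_num))).trans (le_of_eq ?_)
  rw [split_half]
  unfold eN
  ring

lemma tri_three (hf : Measurable f) (hg : Measurable g) (hh : Measurable h) (hK : Measurable K)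
    (hC : ∀ p, ∫⁻ y, K (p + y, y) ^ 2 ≤ C) :
    ∫⁻ q : (ℝ × ℝ) × ℝ × ℝ, (h q.1 * f q.2) * (g (q.1 - q.2) * K q) ≤
      C ^ (1/2 : ℝ) * (eN f * eN g * eN h) := by
  refine (cs _ (by fun_prop) (by fun_prop)).trans ?_
  have e1 : ∫⁻ q : (ℝ × ℝ) × ℝ × ℝ, (h q.1 * f q.2) ^ 2 =
      (∫⁻ p, h p ^ 2) * ∫⁻ p, f p ^ 2 := by
    rw [vol4, lintegral_prod _ (by fun_prop), ← lintegral_mul_const _ (by fun_prop)]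
    refine lintegral_congr fun y => ?_
    simp only [mul_pow]
    rw [lintegral_const_mul _ (by fun_prop)]
  have e2 : ∫⁻ q : (ℝ × ℝ) × ℝ × ℝ, (g (q.1 - q.2) * K q) ^ 2 ≤ C * ∫⁻ p, g p ^ 2 := by
    rw [vol4, lintegral_prod_symm _ (by fun_prop), ← lintegral_const_mul _ (by fun_prop)]
    calc _ = ∫⁻ y : ℝ × ℝ, ∫⁻ x : ℝ × ℝ, (g x * K (x + y, y)) ^ 2 := by
          refine lintegral_congr fun y => ?_
          rw [← lintegral_add_right_eq_self _ y]
          simp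
      _ = ∫⁻ x : ℝ × ℝ, ∫⁻ y : ℝ × ℝ, (g x * K (x + y, y)) ^ 2 :=
          lintegral_lintegral_swap (by fun_prop)
      _ ≤ _ := by
          refine lintegral_mono fun x => ?_
          simp only [mul_pow]
          rw [lintegral_const_mul _ (by fun_prop), mul_comm]
          gcongr
          exact hC x
  rw [e1, split_half]
  refine (mul_le_mul' le_rfl (ENNReal.rpow_le_rpow e2 (by norm_num))).trans (le_of_eq ?_)
  rw [split_half]
  unfold eN
  ring

end tri

/-- The multiplier. -/
noncomputable def eW (γ b b₁ c₁ : ℝ) (q : (ℝ × ℝ) × ℝ × ℝ) : ℝ≥0∞ :=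
  eJ q.2.2 ^ (1/2 : ℝ) * eJ (q.1.1 + q.1.2 ^ 2) ^ (-c₁) * eJ (q.2.1 + γ * |q.2.2| * q.2.2) ^ (-b)
    * eJ (q.1.1 - q.2.1 + (q.1.2 - q.2.2) ^ 2) ^ (-b₁)

lemma eW_meas (γ b b₁ c₁ : ℝ) : Measurable (eW γ b b₁ c₁) := by
  unfold eW; fun_prop

lemma rpow_sq (x : ℝ≥0∞) (s : ℝ) : (x ^ (-s)) ^ 2 = x ^ (-(2 * s)) := by
  rw [← ENNReal.rpow_natCast, ← ENNReal.rpow_mul]; congr 1; push_cast; ring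

lemma eW_sq (γ b b₁ c₁ : ℝ) (q : (ℝ × ℝ) × ℝ × ℝ) : eW γ b b₁ c₁ q ^ 2 =
  eJ q.2.2 * eJ (q.1.1 + q.1.2 ^ 2) ^ (-(2 * c₁)) * eJ (q.2.1 + γ * |q.2.2| * q.2.2) ^ (-(2 * b))
    * eJ (q.1.1 - q.2.1 + (q.1.2 - q.2.2) ^ 2) ^ (-(2 * b₁)) := by
  unfold eW
  have : (eJ q.2.2 ^ (1/2 : ℝ)) ^ 2 = eJ q.2.2 := by
    rw [← ENNReal.rpow_natCast, ← ENNReal.rpow_mul]; norm_num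
  rw [mul_pow, mul_pow, mul_pow, rpow_sq, rpow_sq, rpow_sq, this]

lemma fub (F : ℝ × ℝ → ℝ≥0∞) (hF : Measurable F) : ∫⁻ q, F q = ∫⁻ x, ∫⁻ t, F (t, x) := by
  rw [show (volume : Measure (ℝ × ℝ)) = (volume : Measure ℝ).prod volume from rfl]
  exact lintegral_prod_symm _ hF.aemeasurable

lemma ind_sq {α : Type*} (E : Set α) (W : α → ℝ≥0∞) (q : α) :
    (E.indicator W q) ^ 2 = E.indicator 1 q * W q ^ 2 := by
  by_cases h : q ∈ E <;> simp [h]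

theorem bilinear_ennreal (γ b b₁ c₁ : ℝ) (hγ1 : |γ| ≠ 1)
    (hb : b ∈ Set.Ioo (1/4 : ℝ) (1/2)) (hb₁ : b₁ ∈ Set.Ioo (1/4 : ℝ) (1/2))
    (hc₁ : c₁ ∈ Set.Ioo (1/4 : ℝ) (1/2)) (hsum : 1 ≤ b + b₁ + c₁) :
    ∃ C : ℝ≥0∞, C ≠ ⊤ ∧ ∀ f g h : ℝ × ℝ → ℝ≥0∞,
      Measurable f → Measurable g → Measurable h →
      ∫⁻ q : (ℝ × ℝ) × ℝ × ℝ, h q.1 * f q.2 * g (q.1 - q.2) * eW γ b b₁ c₁ q ≤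
        C * (eN f * eN g * eN h) := by
  obtain ⟨C1, hC1, H1⟩ := sup_one γ b b₁ c₁ hγ1 hb hb₁ hc₁ hsum
  obtain ⟨C2, hC2, H2⟩ := sup_two γ b b₁ c₁ hb hb₁ hc₁ hsum
  obtain ⟨C3, hC3, H3⟩ := sup_three γ b b₁ c₁ hγ1 hb hb₁ hc₁ hsum
  refine ⟨C1 ^ (1/2 : ℝ) + C2 ^ (1/2 : ℝ) + C3 ^ (1/2 : ℝ), by finiteness, ?_⟩
  intro f g h hf hg hh
  set E1 : Set ((ℝ × ℝ) × ℝ × ℝ) := {q | |q.2.2| ≤ 1 ∨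
    |2 * q.1.2 * q.2.2 - q.2.2 ^ 2 - γ * |q.2.2| * q.2.2| ≤ 3 * jb (q.1.1 + q.1.2 ^ 2)} with hE1
  set E2 : Set ((ℝ × ℝ) × ℝ × ℝ) := {q | 1 ≤ |q.2.2| ∧
    |2 * q.1.2 * q.2.2 - q.2.2 ^ 2 - γ * |q.2.2| * q.2.2| ≤
      3 * jb (q.2.1 + γ * |q.2.2| * q.2.2)} with hE2
  set E3 : Set ((ℝ × ℝ) × ℝ × ℝ) := {q | |q.2.2| ≤ 1 ∨
    |2 * q.1.2 * q.2.2 - q.2.2 ^ 2 - γ * |q.2.2| * q.2.2| ≤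
      3 * jb (q.1.1 - q.2.1 + (q.1.2 - q.2.2) ^ 2)} with hE3
  have mjb : ∀ F : (ℝ × ℝ) × ℝ × ℝ → ℝ, Measurable F → Measurable fun q => 3 * jb (F q) :=
    fun F hF => (measurable_jb.comp hF).const_mul 3
  have m1 : MeasurableSet E1 := meas_or (measurableSet_le (by fun_prop) (by fun_prop))
    (measurableSet_le (by fun_prop) (mjb _ (by fun_prop)))
  have m2 : MeasurableSet E2 := meas_and (measurableSet_le (by fun_prop) (by fun_prop))
    (measurableSet_le (by fun_prop) (mjb _ (by fun_prop)))
  have m3 : MeasurableSet E3 := meas_or (measurableSet_le (by fun_prop) (by fun_prop))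
    (measurableSet_le (by fun_prop) (mjb _ (by fun_prop)))
  set W := eW γ b b₁ c₁ with hW
  have hWm : Measurable W := eW_meas _ _ _ _
  have k1 : Measurable (E1.indicator W) := hWm.indicator m1
  have k2 : Measurable (E2.indicator W) := hWm.indicator m2
  have k3 : Measurable (E3.indicator W) := hWm.indicator m3
  have T1 := tri_one hf hg hh k1 (C := C1) (by
    rintro ⟨τ, ξ⟩
    rw [fub _ (by fun_prop)]
    refine le_trans (le_of_eq ?_) (H1 τ ξ)
    refine lintegral_congr fun x => lintegral_congr fun t => ?_
    rw [ind_sq, hW, eW_sq]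
    rfl)
  have T2 := tri_two hf hg hh k2 (C := C2) (by
    rintro ⟨t, x⟩
    rw [fub _ (by fun_prop)]
    refine le_trans (le_of_eq ?_) (H2 t x)
    refine lintegral_congr fun ξ => lintegral_congr fun τ => ?_
    rw [ind_sq, hW, eW_sq]
    rfl)
  have T3 := tri_three hf hg hh k3 (C := C3) (by
    rintro ⟨τ, ξ⟩
    rw [fub _ (by fun_prop)]
    refine le_trans (le_of_eq ?_) (H3 τ ξ)
    refine lintegral_congr fun x => lintegral_congr fun t => ?_
    rw [ind_sq, hW, eW_sq]
    have r1 : τ + t - t + (ξ + x - x) ^ 2 = τ + ξ ^ 2 := by ring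
    have r2 : 2 * (ξ + x) * x - x ^ 2 - γ * |x| * x = 2 * ξ * x + x ^ 2 - γ * |x| * x := by ring
    simp only [Prod.mk_add_mk, r1]
    congr 1
    simp only [Set.indicator, hE3, Set.mem_ofPred_eq, r1, r2, Pi.one_apply])
  have hcov : ∀ q, W q ≤ E1.indicator W q + E2.indicator W q + E3.indicator W q := by
    intro q
    by_cases q1 : q ∈ E1
    · rw [Set.indicator_of_mem q1, add_assoc]; exact le_self_add
    by_cases q3 : q ∈ E3
    · rw [Set.indicator_of_mem q3]; exact le_add_self
    by_cases q2 : q ∈ E2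
    · rw [Set.indicator_of_mem q2, add_right_comm]; exact le_add_self
    exfalso
    simp only [hE1, hE2, hE3, Set.mem_ofPred_eq, not_or, not_and, not_le] at q1 q2 q3
    have q2' := q2 q1.1.le
    have q1' := q1.2
    have q3' := q3.2
    have hid : 2 * q.1.2 * q.2.2 - q.2.2 ^ 2 - γ * |q.2.2| * q.2.2 =
      (q.1.1 + q.1.2 ^ 2) - (q.2.1 + γ * |q.2.2| * q.2.2)
        - (q.1.1 - q.2.1 + (q.1.2 - q.2.2) ^ 2) := by ring
    have t1 := abs_sub ((q.1.1 + q.1.2 ^ 2) - (q.2.1 + γ * |q.2.2| * q.2.2))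
      (q.1.1 - q.2.1 + (q.1.2 - q.2.2) ^ 2)
    have t2 := abs_sub (q.1.1 + q.1.2 ^ 2) (q.2.1 + γ * |q.2.2| * q.2.2)
    rw [← hid] at t1
    unfold jb at q1' q2' q3'
    linarith
  calc _ ≤ ∫⁻ q : (ℝ × ℝ) × ℝ × ℝ, ((f q.2 * g (q.1 - q.2)) * (h q.1 * E1.indicator W q) +
        (h q.1 * g (q.1 - q.2)) * (f q.2 * E2.indicator W q) +
        (h q.1 * f q.2) * (g (q.1 - q.2) * E3.indicator W q)) := by
        refine lintegral_mono fun q => ?_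
        refine (mul_le_mul' le_rfl (hcov q)).trans (le_of_eq ?_)
        ring
    _ ≤ C1 ^ (1/2 : ℝ) * (eN f * eN g * eN h) + C2 ^ (1/2 : ℝ) * (eN f * eN g * eN h) +
        C3 ^ (1/2 : ℝ) * (eN f * eN g * eN h) := by
        rw [lintegral_add_left (by fun_prop), lintegral_add_left (by fun_prop)]
        exact add_le_add (add_le_add T1 T2) T3
    _ = _ := by ring

/-- Dual formulation of the bilinear estimate
`‖uv‖_{X^{0,−c₁}} ≲ ‖u‖_{Y_γ^{−1/2,b}} ‖v‖_{X^{0,b₁}}`.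
The variables are `q.1 = (τ, ξ)` and `q.2 = (τ₁, ξ₁)`. -/
theorem bilinear_estimate_dual_X (γ b b₁ c₁ : ℝ) (hγ : γ ≠ 0) (hγ1 : |γ| ≠ 1)
    (hb : b ∈ Set.Ioo (1/4 : ℝ) (1/2)) (hb₁ : b₁ ∈ Set.Ioo (1/4 : ℝ) (1/2))
    (hc₁ : c₁ ∈ Set.Ioo (1/4 : ℝ) (1/2)) (hsum : 1 ≤ b + b₁ + c₁) :
    ∃ C : ℝ, 0 < C ∧ ∀ f g h : ℝ × ℝ → ℝ,
      Measurable f → Measurable g → Measurable h →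
      (∀ p, 0 ≤ f p) → (∀ p, 0 ≤ g p) → (∀ p, 0 ≤ h p) →
      (∫⁻ q : (ℝ × ℝ) × ℝ × ℝ,
        ENNReal.ofReal (
          h q.1 * jb q.2.2 ^ (1/2 : ℝ) * f q.2 * g (q.1 - q.2) /
          (jb (q.1.1 + q.1.2 ^ 2) ^ c₁ * jb (q.2.1 + γ * |q.2.2| * q.2.2) ^ b
            * jb (q.1.1 - q.2.1 + (q.1.2 - q.2.2) ^ 2) ^ b₁)))
      ≤ ENNReal.ofReal C * l2R2 f * l2R2 g * l2R2 h := by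
  obtain ⟨C, hC, H⟩ := bilinear_ennreal γ b b₁ c₁ hγ1 hb hb₁ hc₁ hsum
  refine ⟨C.toReal + 1, by positivity, ?_⟩
  intro f g h hf hg hh hf0 hg0 hh0
  have hH := H (fun p => ENNReal.ofReal (f p)) (fun p => ENNReal.ofReal (g p))
    (fun p => ENNReal.ofReal (h p)) (by fun_prop) (by fun_prop) (by fun_prop)
  have hCC : C ≤ ENNReal.ofReal (C.toReal + 1) := by
    rw [← ENNReal.ofReal_toReal hC]
    exact ENNReal.ofReal_le_ofReal (by simp [ENNReal.toReal_nonneg])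
  calc _ = _ := ?_
    _ ≤ _ := hH
    _ ≤ ENNReal.ofReal (C.toReal + 1) * (l2R2 f * l2R2 g * l2R2 h) := mul_le_mul' hCC le_rfl
    _ = _ := by ring
  refine lintegral_congr fun q => ?_
  have p0 := jb_pos q.2.2
  have p1 := jb_pos (q.1.1 + q.1.2 ^ 2)
  have p2 := jb_pos (q.2.1 + γ * |q.2.2| * q.2.2)
  have p3 := jb_pos (q.1.1 - q.2.1 + (q.1.2 - q.2.2) ^ 2)
  have f0 := hf0 q.2
  have g0 := hg0 (q.1 - q.2)
  have h0 := hh0 q.1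
  unfold eW eJ
  rw [ENNReal.ofReal_rpow_of_pos p0, ENNReal.ofReal_rpow_of_pos p1, ENNReal.ofReal_rpow_of_pos p2,
    ENNReal.ofReal_rpow_of_pos p3, ← ENNReal.ofReal_mul (by positivity),
    ← ENNReal.ofReal_mul (by positivity), ← ENNReal.ofReal_mul (by positivity),
    ← ENNReal.ofReal_mul (by positivity), ← ENNReal.ofReal_mul (by positivity),
    ← ENNReal.ofReal_mul (by positivity)]
  congr 1
  rw [Real.rpow_neg p1.le, Real.rpow_neg p2.le, Real.rpow_neg p3.le]
  field_simp
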